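/- Let n ≥ 4 and let M = (m_{pq}) be an invertible 3×3 complex matrix with M ≠ I₃. For 1 ≤ i ≤ n−1 set σᵢ = Lᵢ(M) ∈ M_{n+1}(ℂ), and assume the braid relations hold: σᵢσⱼ = σⱼσᵢ whenever |i−j| ≥ 2, and σᵢσ_{i+1}σᵢ = σ_{i+1}σᵢσ_{i+1} for 1 ≤ i ≤ n−2. Then M has one of the following eight forms: (1) [[1,0,0],[0,m₂₂,m₂₃],[0,(1−m₂₂)/m₂₃,0]] with m₂₂ ≠ 1 and m₂₃ ≠ 0; (2) [[0,m₁₂,0],[(1−m₂₂)/m₁₂,m₂₂,0],[0,0,1]] with m₂₂ ≠ 1 and m₁₂ ≠ 0; (3) [[1,−m₂₂/m₃₂,0],[0,m₂₂,0],[0,m₃₂,1]] with m₂₂m₃₂ ≠ 0; (4) [[1,0,0],[−m₂₂/m₂₃,m₂₂,m₂₃],[0,0,1]] with m₂₂m₂₃ ≠ 0; (5) [[1,0,0],[0,0,m₂₃],[0,m₃₂,1−m₂₃m₃₂]] with m₂₃m₃₂ ≠ 0; (6) [[1−m₁₂m₂₁,m₁₂,0],[m₂₁,0,0],[0,0,1]]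 with m₁₂m₂₁ ≠ 0; (7) [[1,0,0],[0,0,m₂₃],[0,m₃₂,0]] with m₂₃m₃₂ ≠ 0; (8) [[0,m₁₂,0],[m₂₁,0,0],[0,0,1]] with m₁₂m₂₁ ≠ 0. -/

import Mathlib

open Matrix

def loc3 (m i : ℕ) (P : Matrix (Fin 3) (Fin 3) ℂ) : Matrix (Fin m) (Fin m) ℂ :=
  Matrix.of fun r s =>
    if (r : ℕ) = i - 1 ∧ (s : ℕ) = i - 1 then P 0 0
    else if (r : ℕ) = i - 1 ∧ (s : ℕ) = i then P 0 1
    else if (r : ℕ) = i - 1 ∧ (s : ℕ) = i + 1 then P 0 2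
    else if (r : ℕ) = i ∧ (s : ℕ) = i - 1 then P 1 0
    else if (r : ℕ) = i ∧ (s : ℕ) = i then P 1 1
    else if (r : ℕ) = i ∧ (s : ℕ) = i + 1 then P 1 2
    else if (r : ℕ) = i + 1 ∧ (s : ℕ) = i - 1 then P 2 0
    else if (r : ℕ) = i + 1 ∧ (s : ℕ) = i then P 2 1
    else if (r : ℕ) = i + 1 ∧ (s : ℕ) = i + 1 then P 2 2
    else if r = s then 1 else 0

theorem submatrix_castAdd_mul_of_upper_right_eq_zero {R : Type*} [NonUnitalNonAssocSemiring R]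
    {k m : ℕ} (A B : Matrix (Fin (k + m)) (Fin (k + m)) R)
    (hA : ∀ r s, A (Fin.castAdd m r) (Fin.natAdd k s) = 0) :
    (A * B).submatrix (Fin.castAdd m) (Fin.castAdd m) =
      A.submatrix (Fin.castAdd m) (Fin.castAdd m) *
        B.submatrix (Fin.castAdd m) (Fin.castAdd m) := by
  ext r s
  simp [Matrix.mul_apply, Fin.sum_univ_add, hA]

theorem loc3_submatrix_castAdd (k m i : ℕ) (P : Matrix (Fin 3) (Fin 3) ℂ) :
    (loc3 (k + m) i P).submatrix (Fin.castAdd m) (Fin.castAdd m) = loc3 k i P := by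
  ext r s
  simp [loc3]

theorem loc3_upper_right_eq_zero {k m i : ℕ} (hi : i + 1 < k) (P : Matrix (Fin 3) (Fin 3) ℂ)
    (r : Fin k) (s : Fin m) : loc3 (k + m) i P (Fin.castAdd m r) (Fin.natAdd k s) = 0 := by
  have h1 : k + (s : ℕ) ≠ i - 1 := by omega
  have h2 : k + (s : ℕ) ≠ i := by omega
  have h3 : k + (s : ℕ) ≠ i + 1 := by omega
  have h4 : Fin.castAdd m r ≠ Fin.natAdd k s := by
    intro h
    have := congrArg Fin.val h
    simp only [Fin.val_castAdd, Fin.val_natAdd] at this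
    omega
  simp [loc3, h1, h2, h3, h4]

/-- Restriction of a product with a local factor to the leading coordinates. -/
theorem loc3_mul_submatrix_castAdd {k m i : ℕ} (hi : i + 1 < k) (P : Matrix (Fin 3) (Fin 3) ℂ)
    (B : Matrix (Fin (k + m)) (Fin (k + m)) ℂ) :
    (loc3 (k + m) i P * B).submatrix (Fin.castAdd m) (Fin.castAdd m) =
      loc3 k i P * B.submatrix (Fin.castAdd m) (Fin.castAdd m) := by
  rw [submatrix_castAdd_mul_of_upper_right_eq_zero _ _ (loc3_upper_right_eq_zero hi P),
    loc3_submatrix_castAdd]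

theorem loc3_five_one (a b c d e f g h k : ℂ) :
    loc3 5 1 !![a, b, c; d, e, f; g, h, k] =
      !![a, b, c, 0, 0; d, e, f, 0, 0; g, h, k, 0, 0; 0, 0, 0, 1, 0; 0, 0, 0, 0, 1] := by
  ext r s
  fin_cases r <;> fin_cases s <;> simp [loc3]

theorem loc3_five_three (a b c d e f g h k : ℂ) :
    loc3 5 3 !![a, b, c; d, e, f; g, h, k] =
      !![1, 0, 0, 0, 0; 0, 1, 0, 0, 0; 0, 0, a, b, c; 0, 0, d, e, f; 0, 0, g, h, k] := by
  ext r s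
  fin_cases r <;> fin_cases s <;> simp [loc3]

theorem loc3_four_one (a b c d e f g h k : ℂ) :
    loc3 4 1 !![a, b, c; d, e, f; g, h, k] =
      !![a, b, c, 0; d, e, f, 0; g, h, k, 0; 0, 0, 0, 1] := by
  ext r s
  fin_cases r <;> fin_cases s <;> simp [loc3]

theorem loc3_four_two (a b c d e f g h k : ℂ) :
    loc3 4 2 !![a, b, c; d, e, f; g, h, k] =
      !![1, 0, 0, 0; 0, a, b, c; 0, d, e, f; 0, g, h, k] := by
  ext r s
  fin_cases r <;> fin_cases s <;> simp [loc3]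

theorem stmt7 (n : ℕ) (hn : 4 ≤ n) (M : Matrix (Fin 3) (Fin 3) ℂ)
    (hM : IsUnit M) (hMne : M ≠ 1)
    (hcomm : ∀ i j : ℕ, 1 ≤ i → i ≤ n - 1 → 1 ≤ j → j ≤ n - 1 →
      (i + 2 ≤ j ∨ j + 2 ≤ i) →
      loc3 (n + 1) i M * loc3 (n + 1) j M = loc3 (n + 1) j M * loc3 (n + 1) i M)
    (hbraid : ∀ i : ℕ, 1 ≤ i → i ≤ n - 2 →
      loc3 (n + 1) i M * loc3 (n + 1) (i + 1) M * loc3 (n + 1) i M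
        = loc3 (n + 1) (i + 1) M * loc3 (n + 1) i M * loc3 (n + 1) (i + 1) M) :
    (∃ m22 m23 : ℂ, m22 ≠ 1 ∧ m23 ≠ 0 ∧
        M = !![1, 0, 0; 0, m22, m23; 0, (1 - m22) / m23, 0]) ∨
    (∃ m12 m22 : ℂ, m22 ≠ 1 ∧ m12 ≠ 0 ∧
        M = !![0, m12, 0; (1 - m22) / m12, m22, 0; 0, 0, 1]) ∨
    (∃ m22 m32 : ℂ, m22 * m32 ≠ 0 ∧
        M = !![1, -m22 / m32, 0; 0, m22, 0; 0, m32, 1]) ∨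
    (∃ m22 m23 : ℂ, m22 * m23 ≠ 0 ∧
        M = !![1, 0, 0; -m22 / m23, m22, m23; 0, 0, 1]) ∨
    (∃ m23 m32 : ℂ, m23 * m32 ≠ 0 ∧
        M = !![1, 0, 0; 0, 0, m23; 0, m32, 1 - m23 * m32]) ∨
    (∃ m12 m21 : ℂ, m12 * m21 ≠ 0 ∧
        M = !![1 - m12 * m21, m12, 0; m21, 0, 0; 0, 0, 1]) ∨
    (∃ m23 m32 : ℂ, m23 * m32 ≠ 0 ∧
        M = !![1, 0, 0; 0, 0, m23; 0, m32, 0]) ∨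
    (∃ m12 m21 : ℂ, m12 * m21 ≠ 0 ∧
        M = !![0, m12, 0; m21, 0, 0; 0, 0, 1]) := by
  have comm : loc3 5 1 M * loc3 5 3 M = loc3 5 3 M * loc3 5 1 M := by
    obtain ⟨m, hm⟩ : ∃ m, n + 1 = 5 + m := ⟨n - 4, by omega⟩
    have h := hcomm 1 3 (by omega) (by omega) (by omega) (by omega) (by omega)
    rw [hm] at h
    have h := congrArg (fun A => A.submatrix (Fin.castAdd m) (Fin.castAdd m)) h
    simpa only [loc3_mul_submatrix_castAdd (k := 5) (i := 1) (by omega),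
      loc3_mul_submatrix_castAdd (k := 5) (i := 3) (by omega), loc3_submatrix_castAdd] using h
  have braid : loc3 4 1 M * (loc3 4 2 M * loc3 4 1 M) =
      loc3 4 2 M * (loc3 4 1 M * loc3 4 2 M) := by
    obtain ⟨m, hm⟩ : ∃ m, n + 1 = 4 + m := ⟨n - 3, by omega⟩
    have h := hbraid 1 (by omega) (by omega)
    rw [hm, Matrix.mul_assoc, Matrix.mul_assoc] at h
    have h := congrArg (fun A => A.submatrix (Fin.castAdd m) (Fin.castAdd m)) h
    simpa only [loc3_mul_submatrix_castAdd (k := 4) (i := 1) (by omega), Nat.reduceAdd,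
      loc3_mul_submatrix_castAdd (k := 4) (i := 2) (by omega), loc3_submatrix_castAdd] using h
  have hdet : M.det ≠ 0 := ((Matrix.isUnit_iff_isUnit_det M).1 hM).ne_zero
  clear hcomm hbraid hM
  obtain ⟨a, b, c, d, e, f, g, h, k, rfl⟩ : ∃ a b c d e f g h k : ℂ,
      M = !![a, b, c; d, e, f; g, h, k] := ⟨_, _, _, _, _, _, _, _, _, Matrix.eta_fin_three M⟩
  rw [loc3_five_one, loc3_five_three] at comm
  rw [loc3_four_one, loc3_four_two] at braid
  have hc : c = 0 := by
    have := congrFun₂ comm 0 4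
    simpa [Matrix.mul_apply, Fin.sum_univ_five] using this
  have hg : g = 0 := by
    have := congrFun₂ comm 4 0
    simpa [Matrix.mul_apply, Fin.sum_univ_five] using this
  subst hc hg
  have E := fun r s => congrFun₂ comm r s
  have B := fun r s => congrFun₂ braid r s
  simp [Matrix.mul_apply, Fin.sum_univ_succ, Fin.forall_fin_succ] at E B
  rw [Matrix.det_fin_three] at hdet
  simp at hdet
  have hne : ¬(a = 1 ∧ b = 0 ∧ d = 0 ∧ e = 1 ∧ f = 0 ∧ h = 0 ∧ k = 1) := by
    rintro ⟨rfl, rfl, rfl, rfl, rfl, rfl, rfl⟩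
    exact hMne Matrix.one_fin_three.symm
  obtain ⟨⟨E1, E2⟩, ⟨E3, -, E4⟩, E5, E6⟩ := E
  obtain ⟨⟨B00, B01, -⟩, ⟨B10, B11, B12, -⟩, ⟨-, B21, B22, -⟩, -, -, B33⟩ := B
  clear comm braid hMne hn n
  have support : (b = 0 ∧ d = 0) ∨ (f = 0 ∧ h = 0) ∨ (b ≠ 0 ∧ h ≠ 0 ∧ f = 0 ∧ d = 0) ∨
      (d ≠ 0 ∧ f ≠ 0 ∧ b = 0 ∧ h = 0) := by
    grind
  rcases support with ⟨rfl, rfl⟩ | ⟨rfl, rfl⟩ | ⟨hb, hh, rfl, rfl⟩ | ⟨hd, hf, rfl, rfl⟩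
  · obtain rfl : a = 1 := by grind
    have hf : f ≠ 0 := by rintro rfl; grind
    have hh : h ≠ 0 := by rintro rfl; grind
    have hek : e = 0 ∨ k = 0 := by grind
    by_cases hk : k = 0
    · subst hk
      by_cases he : e = 0
      · subst he
        iterate 6 right
        exact .inl ⟨f, h, mul_ne_zero hf hh, rfl⟩
      · have he' : e = 1 - f * h := by grind
        have hh' : h = (1 - e) / f := by rw [he']; field_simp; ring
        exact .inl ⟨e, f, by grind, hf, by rw [← hh']⟩
    · obtain rfl : e = 0 := by grind
      obtain rfl : k = 1 - f * h := by grind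
      iterate 4 right
      exact .inl ⟨f, h, mul_ne_zero hf hh, rfl⟩
  · obtain rfl : k = 1 := by grind
    have hb : b ≠ 0 := by rintro rfl; grind
    have hd : d ≠ 0 := by rintro rfl; grind
    have hae : a = 0 ∨ e = 0 := by grind
    by_cases ha : a = 0
    · subst ha
      by_cases he : e = 0
      · subst he
        iterate 7 right
        exact ⟨b, d, mul_ne_zero hb hd, rfl⟩
      · have he' : e = 1 - b * d := by grind
        have hd' : d = (1 - e) / b := by rw [he']; field_simp; ring
        exact .inr (.inl ⟨b, e, by grind, hb, by rw [← hd']⟩)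
    · obtain rfl : e = 0 := by grind
      obtain rfl : a = 1 - b * d := by grind
      iterate 5 right
      exact .inl ⟨b, d, mul_ne_zero hb hd, rfl⟩
  · obtain rfl : a = 1 := by grind
    obtain rfl : k = 1 := by grind
    have he : e = -(b * h) := by grind
    have hb' : b = -e / h := by rw [he]; field_simp
    exact .inr (.inr (.inl ⟨e, h, by grind, by rw [← hb']⟩))
  · obtain rfl : a = 1 := by grind
    obtain rfl : k = 1 := by grind
    have he : e = -(f * d) := by grind
    have hd' : d = -e / f := by rw [he]; field_simp
    exact .inr (.inr (.inr (.inl ⟨e, f, by grind, by rw [← hd']⟩)))
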